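/- arXiv:1711.08274 — 2 statements merged into one kernel-verified Lean document; each statement's English description precedes it below -/
import Mathlib

section
/- Let ω, σ be weights on ℝⁿ and let α, β, γ ≥ 0 with α > 0 and α + β + γ ≥ 1. Let 𝒮 be an η-sparse collection of dyadic cubes and R a cube. Then there is a constant C depending only on n, η, α, β, γ such that Σ_{Q∈𝒮, Q⊆R} |Q|^α σ(Q)^β ω(Q)^γ ≤ C · |R|^α σ(R)^β ω(R)^γ. -/
open MeasureTheory ENNReal Set

noncomputable section

/-- An axis-parallel (closed) cube in ℝⁿ with corner `corner` and side length `side > 0`. -/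
structure Cube (n : ℕ) where
  corner : Fin n → ℝ
  side : ℝ
  side_pos : 0 < side

namespace Cube

/-- The set of points of the cube. -/
def carrier {n : ℕ} (Q : Cube n) : Set (Fin n → ℝ) :=
  {x | ∀ i, Q.corner i ≤ x i ∧ x i ≤ Q.corner i + Q.side}

/-- The volume `|Q|` of the cube. -/
def vol {n : ℕ} (Q : Cube n) : ℝ := Q.side ^ n

/-- `Q` is a cube of the standard dyadic grid: `Q = 2^{-j}([0,1]^n + m)`. -/
def IsDyadic {n : ℕ} (Q : Cube n) : Prop :=
  ∃ (j : ℤ) (m : Fin n → ℤ),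
    Q.side = (2 : ℝ) ^ (-j) ∧ ∀ i, Q.corner i = (m i : ℝ) * (2 : ℝ) ^ (-j)

end Cube

/-- `η`-sparseness of a collection of cubes: there are pairwise disjoint measurable
subsets `E Q ⊆ Q` with `|E Q| ≥ η |Q|`. -/
def IsSparse {n : ℕ} (η : ℝ) (S : Set (Cube n)) : Prop :=
  ∃ E : Cube n → Set (Fin n → ℝ),
    (∀ Q ∈ S, MeasurableSet (E Q)) ∧ (∀ Q ∈ S, E Q ⊆ Q.carrier) ∧
    (S.Pairwise (fun Q Q' => Disjoint (E Q) (E Q'))) ∧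
    (∀ Q ∈ S, ENNReal.ofReal (η * Q.vol) ≤ volume (E Q))

/-- A weight: a nonnegative locally integrable function on ℝⁿ. -/
def IsWeight {n : ℕ} (w : (Fin n → ℝ) → ℝ) : Prop :=
  MeasureTheory.LocallyIntegrable w volume ∧ ∀ x, 0 ≤ w x

/-- `ω(Q) = ∫_Q ω`. -/
def wMass {n : ℕ} (w : (Fin n → ℝ) → ℝ) (Q : Cube n) : ℝ≥0∞ :=
  ∫⁻ x in Q.carrier, ENNReal.ofReal (w x)

/-- The weighted `L^s` (quasi)norm `‖f‖_{L^s_w} = (∫ |f|^s w)^{1/s}`, valued in `ℝ≥0∞`. -/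
def wNorm {n : ℕ} (s : ℝ) (w f : (Fin n → ℝ) → ℝ) : ℝ≥0∞ :=
  (∫⁻ x, ENNReal.ofReal (|f x| ^ s) * ENNReal.ofReal (w x)) ^ (1 / s)

/-- The weighted `L^s` (quasi)norm of an `ℝ≥0∞`-valued function. -/
def eNorm {n : ℕ} (s : ℝ) (w : (Fin n → ℝ) → ℝ) (g : (Fin n → ℝ) → ℝ≥0∞) : ℝ≥0∞ :=
  (∫⁻ x, g x ^ s * ENNReal.ofReal (w x)) ^ (1 / s)

/-- `Σ_{Q ∈ D} g(Q) 1_Q`. -/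
def cubeSum {n : ℕ} (D : Set (Cube n)) (g : Cube n → ℝ≥0∞) (x : Fin n → ℝ) : ℝ≥0∞ :=
  ∑' Q : D, Q.1.carrier.indicator (fun _ => g Q.1) x

/-- The sparse operator `A^{r,α}_S f = (Σ_{Q∈S} (|Q|^{-α} ∫_Q f)^r 1_Q)^{1/r}`
(for nonnegative `f`; negative values are truncated). -/
def sparseOp {n : ℕ} (S : Set (Cube n)) (r α : ℝ) (f : (Fin n → ℝ) → ℝ)
    (x : Fin n → ℝ) : ℝ≥0∞ :=
  (cubeSum S
      (fun Q => ((ENNReal.ofReal Q.vol) ^ (-α) * ∫⁻ y in Q.carrier, ENNReal.ofReal (f y)) ^ r)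
      x) ^ (1 / r)

/-- The Hardy–Littlewood maximal function over axis-parallel cubes. -/
def maximal {n : ℕ} (w : (Fin n → ℝ) → ℝ) (x : Fin n → ℝ) : ℝ≥0∞ :=
  ⨆ (Q : Cube n) (_ : x ∈ Q.carrier),
    (ENNReal.ofReal Q.vol)⁻¹ * ∫⁻ y in Q.carrier, ENNReal.ofReal |w y|

/-- The Fujii–Wilson `A∞`-characteristic `[w]_{A∞} = sup_Q ω(Q)⁻¹ ∫_Q M(1_Q ω)`. -/
def AinfChar {n : ℕ} (w : (Fin n → ℝ) → ℝ) : ℝ≥0∞ :=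
  ⨆ Q : Cube n, (wMass w Q)⁻¹ * ∫⁻ x in Q.carrier, maximal (Q.carrier.indicator w) x

/-- The two-weight characteristic
`[ω,σ]_{A^α_{pq}(S)} = sup_{Q∈S} |Q|^{-α} ω(Q)^{1/q} σ(Q)^{1/p'}` (here `1/p' = 1 - 1/p`). -/
def twoWeightChar {n : ℕ} (p q α : ℝ) (S : Set (Cube n)) (w σ' : (Fin n → ℝ) → ℝ) : ℝ≥0∞ :=
  ⨆ Q ∈ S, (ENNReal.ofReal Q.vol) ^ (-α) * wMass w Q ^ (1 / q) * wMass σ' Q ^ (1 - 1 / p)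

/-- The one-weight characteristic
`[w]_{A_{pq}} = sup_Q (|Q|⁻¹ ∫_Q w^q)(|Q|⁻¹ ∫_Q w^{-p'})^{q/p'}`, `p' = p/(p-1)`. -/
def ApqChar {n : ℕ} (p q : ℝ) (w : (Fin n → ℝ) → ℝ) : ℝ≥0∞ :=
  ⨆ Q : Cube n,
    ((ENNReal.ofReal Q.vol)⁻¹ * ∫⁻ x in Q.carrier, (ENNReal.ofReal (w x)) ^ q) *
      ((ENNReal.ofReal Q.vol)⁻¹ *
          ∫⁻ x in Q.carrier, (ENNReal.ofReal (w x)) ^ (-(p / (p - 1)))) ^ (q / (p / (p - 1)))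

/-- The testing constant `𝒯`. -/
def testT {n : ℕ} (p q r α : ℝ) (S : Set (Cube n)) (w σ' : (Fin n → ℝ) → ℝ) : ℝ≥0∞ :=
  ⨆ R ∈ S,
    wMass σ' R ^ (-(r / p)) *
      eNorm (q / r) w
        (cubeSum {Q | Q ∈ S ∧ Q.carrier ⊆ R.carrier}
          (fun Q => (ENNReal.ofReal Q.vol) ^ (-(α * r)) * wMass σ' Q ^ r))

/-- The testing constant `𝒯*`; here `1/(q/r)' = 1 - r/q` and `(p/r)' = (p/r)/((p/r)-1)`. -/
def testTstar {n : ℕ} (p q r α : ℝ) (S : Set (Cube n)) (w σ' : (Fin n → ℝ) → ℝ) : ℝ≥0∞ :=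
  ⨆ R ∈ S,
    wMass w R ^ (-(1 - r / q)) *
      eNorm ((p / r) / (p / r - 1)) σ'
        (cubeSum {Q | Q ∈ S ∧ Q.carrier ⊆ R.carrier}
          (fun Q => (ENNReal.ofReal Q.vol) ^ (-(α * r)) * wMass σ' Q ^ (r - 1) * wMass w Q))

/-- The operator (quasi)norm of `A^{r,α}_S(·σ) : L^p_σ → L^q_ω`, i.e. the least constant `K`
with `‖A^{r,α}_S(fσ)‖_{L^q_ω} ≤ K ‖f‖_{L^p_σ}` for all `f`. -/
def sparseOpNorm {n : ℕ} (p q r α : ℝ) (S : Set (Cube n)) (w σ' : (Fin n → ℝ) → ℝ) : ℝ≥0∞ :=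
  sInf {K : ℝ≥0∞ | ∀ f : (Fin n → ℝ) → ℝ, Measurable f →
    eNorm q w (sparseOp S r α (fun y => f y * σ' y)) ≤ K * wNorm p σ' f}

namespace Cube

variable {n : ℕ}

theorem carrier_eq_Icc (Q : Cube n) :
    Q.carrier = Icc Q.corner (fun i => Q.corner i + Q.side) := by
  ext x
  simp [carrier, Pi.le_def, forall_and]

theorem measurableSet_carrier (Q : Cube n) : MeasurableSet Q.carrier := by
  rw [carrier_eq_Icc]
  exact measurableSet_Icc

theorem vol_pos (Q : Cube n) : 0 < Q.vol := pow_pos Q.side_pos n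

theorem volume_carrier (Q : Cube n) : volume Q.carrier = ENNReal.ofReal Q.vol := by
  rw [carrier_eq_Icc, Real.volume_Icc_pi]
  simp [vol, ENNReal.ofReal_pow Q.side_pos.le]

/-- In positive dimension, a cube is determined by its set of points. -/
theorem carrier_injective (hn : 1 ≤ n) : Function.Injective (carrier : Cube n → _) := by
  intro Q Q' h
  rw [carrier_eq_Icc, carrier_eq_Icc] at h
  have hle : Q.corner ≤ fun i => Q.corner i + Q.side := fun i => by
    simpa using Q.side_pos.le
  have hle' : Q'.corner ≤ fun i => Q'.corner i + Q'.side := fun i => by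
    simpa using Q'.side_pos.le
  obtain ⟨h1, h2⟩ := (Icc_subset_Icc_iff hle).1 h.subset
  obtain ⟨h3, h4⟩ := (Icc_subset_Icc_iff hle').1 h.superset
  have hc : Q.corner = Q'.corner := le_antisymm h3 h1
  have hs := congrFun (le_antisymm h2 h4) ⟨0, hn⟩
  cases Q
  cases Q'
  simp_all

theorem IsDyadic.subset_or_volume_inter_of_side_le {Q Q' : Cube n} (hQ : Q.IsDyadic)
    (hQ' : Q'.IsDyadic) (hside : Q.side ≤ Q'.side) :
    Q.carrier ⊆ Q'.carrier ∨ volume (Q.carrier ∩ Q'.carrier) = 0 := by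
  obtain ⟨j, m, hs, hc⟩ := hQ
  obtain ⟨j', m', hs', hc'⟩ := hQ'
  have hj : j' ≤ j := by
    rw [hs, hs', zpow_le_zpow_iff_right₀ (by norm_num)] at hside
    lia
  obtain ⟨k, hk⟩ := Int.eq_ofNat_of_zero_le (sub_nonneg.2 hj)
  set s : ℝ := (2 : ℝ) ^ (-j) with hsdef
  have hspos : 0 < s := by positivity
  have hs2 : (2 : ℝ) ^ (-j') = 2 ^ k * s := by
    rw [hsdef, ← zpow_natCast, ← zpow_add₀ (by norm_num)]
    congr 1
    lia
  rw [hs2] at hs' hc'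
  have null (i : Fin n) (c : ℝ)
      (h : ∀ x ∈ Q.carrier ∩ Q'.carrier, x i = c) :
      volume (Q.carrier ∩ Q'.carrier) = 0 := by
    refine measure_mono_null h ?_
    rw [volume_pi]
    exact Measure.pi_hyperplane (fun _ : Fin n => (volume : Measure ℝ)) i c
  by_cases hall : ∀ i, m' i * 2 ^ k ≤ m i ∧ m i + 1 ≤ (m' i + 1) * 2 ^ k
  · left
    intro x hx i
    obtain ⟨h1, h2⟩ := hall i
    have h1' : (m' i : ℝ) * 2 ^ k ≤ m i := by exact_mod_cast h1
    have h2' : (m i : ℝ) + 1 ≤ (m' i + 1) * 2 ^ k := by exact_mod_cast h2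
    have h3 := mul_le_mul_of_nonneg_right h1' hspos.le
    have h4 := mul_le_mul_of_nonneg_right h2' hspos.le
    have := hx i
    rw [hc, hs] at this
    rw [hc', hs']
    constructor <;> nlinarith
  · right
    push Not at hall
    obtain ⟨i, hi⟩ := hall
    by_cases hlt : m' i * 2 ^ k ≤ m i
    · have h2 : (m' i + 1) * 2 ^ k ≤ m i := by have := hi hlt; lia
      have h2' : ((m' i : ℝ) + 1) * 2 ^ k ≤ m i := by exact_mod_cast h2
      have h4 := mul_le_mul_of_nonneg_right h2' hspos.le
      refine null i (m i * s) fun x hx => ?_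
      have hx1 := hx.1 i
      have hx2 := hx.2 i
      rw [hc] at hx1
      rw [hc', hs'] at hx2
      apply le_antisymm <;> nlinarith
    · have h2 : m i + 1 ≤ m' i * 2 ^ k := by lia
      have h2' : (m i : ℝ) + 1 ≤ m' i * 2 ^ k := by exact_mod_cast h2
      have h4 := mul_le_mul_of_nonneg_right h2' hspos.le
      refine null i (m' i * (2 ^ k * s)) fun x hx => ?_
      have hx1 := hx.1 i
      have hx2 := hx.2 i
      rw [hc, hs] at hx1
      rw [hc'] at hx2
      apply le_antisymm <;> nlinarith

theorem IsDyadic.subset_or_subset_or_aedisjoint {Q Q' : Cube n} (hQ : Q.IsDyadic)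
    (hQ' : Q'.IsDyadic) :
    Q.carrier ⊆ Q'.carrier ∨ Q'.carrier ⊆ Q.carrier ∨
      AEDisjoint volume Q.carrier Q'.carrier := by
  rcases le_total Q.side Q'.side with h | h
  · rcases hQ.subset_or_volume_inter_of_side_le hQ' h with h | h
    · exact Or.inl h
    · exact Or.inr (Or.inr h)
  · rcases hQ'.subset_or_volume_inter_of_side_le hQ h with h | h
    · exact Or.inr (Or.inl h)
    · rw [inter_comm] at h
      exact Or.inr (Or.inr h)

open Classical in
/-- The members of a finite family of cubes that are maximal with respect to inclusion. -/
def maximalCubes (F : Finset (Cube n)) : Finset (Cube n) :=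
  {Q ∈ F | MaximalFor (· ∈ F) carrier Q}

theorem maximalCubes_subset (F : Finset (Cube n)) : maximalCubes F ⊆ F := by
  classical
  exact Finset.filter_subset _ _

theorem exists_mem_maximalCubes {F : Finset (Cube n)} {Q : Cube n} (hQ : Q ∈ F) :
    ∃ Q' ∈ maximalCubes F, Q.carrier ⊆ Q'.carrier := by
  classical
  obtain ⟨P, hP⟩ := Finset.exists_maximalFor carrier {P ∈ F | Q.carrier ⊆ P.carrier}
    ⟨Q, by simp [hQ]⟩
  have hPF := Finset.mem_filter.1 hP.1
  refine ⟨P, Finset.mem_filter.2 ⟨hPF.1, hPF.1, fun P' hP' hle => ?_⟩, hPF.2⟩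
  exact hP.2 (Finset.mem_filter.2 ⟨hP', hPF.2.trans hle⟩) hle

theorem pairwise_aedisjoint_maximalCubes (hn : 1 ≤ n) {F : Finset (Cube n)}
    (hF : ∀ Q ∈ F, Q.IsDyadic) :
    (maximalCubes F : Set (Cube n)).Pairwise
      (Function.onFun (AEDisjoint volume) carrier) := by
  classical
  intro Q hQ Q' hQ' hne
  obtain ⟨hQF, hQmax⟩ := Finset.mem_filter.1 (Finset.mem_coe.1 hQ)
  obtain ⟨hQF', hQmax'⟩ := Finset.mem_filter.1 (Finset.mem_coe.1 hQ')
  rcases (hF Q hQF).subset_or_subset_or_aedisjoint (hF Q' hQF') with h | h | h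
  · exact absurd (carrier_injective hn (h.antisymm (hQmax.2 hQF' h))) hne
  · exact absurd (carrier_injective hn ((hQmax'.2 hQF h).antisymm h)) hne
  · exact h

theorem sum_measure_maximalCubes_le (hn : 1 ≤ n) {F : Finset (Cube n)}
    (hF : ∀ Q ∈ F, Q.IsDyadic) {R : Cube n} (hR : ∀ Q ∈ F, Q.carrier ⊆ R.carrier)
    {μ : Measure (Fin n → ℝ)} (hμ : μ ≪ volume) :
    ∑ Q ∈ maximalCubes F, μ Q.carrier ≤ μ R.carrier := by
  rw [← measure_biUnion_finset₀
    (fun Q hQ Q' hQ' hne => hμ (pairwise_aedisjoint_maximalCubes hn hF hQ hQ' hne))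
    (fun Q _ => Q.measurableSet_carrier.nullMeasurableSet)]
  exact measure_mono (iUnion₂_subset fun Q hQ => hR Q (maximalCubes_subset F hQ))

end Cube

theorem wMass_eq_withDensity {n : ℕ} (w : (Fin n → ℝ) → ℝ) (Q : Cube n) :
    wMass w Q = volume.withDensity (fun x => ENNReal.ofReal (w x)) Q.carrier :=
  (withDensity_apply _ Q.measurableSet_carrier).symm

/-- The cubes of a finite subfamily of a sparse family are controlled by any measurable set
containing them. -/
theorem IsSparse.sum_vol_le {n : ℕ} {η : ℝ} {S : Set (Cube n)} (hS : IsSparse η S)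
    {F : Finset (Cube n)} (hF : ∀ Q ∈ F, Q ∈ S) {A : Set (Fin n → ℝ)}
    (hA : ∀ Q ∈ F, Q.carrier ⊆ A) :
    ∑ Q ∈ F, ENNReal.ofReal (η * Q.vol) ≤ volume A := by
  obtain ⟨E, hmeas, hsub, hdisj, hvol⟩ := hS
  calc ∑ Q ∈ F, ENNReal.ofReal (η * Q.vol) ≤ ∑ Q ∈ F, volume (E Q) :=
        Finset.sum_le_sum fun Q hQ => hvol Q (hF Q hQ)
    _ = volume (⋃ Q ∈ F, E Q) :=
        (measure_biUnion_finset (fun Q hQ Q' hQ' hne => hdisj (hF Q hQ) (hF Q' hQ') hne)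
          fun Q hQ => hmeas Q (hF Q hQ)).symm
    _ ≤ volume A :=
        measure_mono (iUnion₂_subset fun Q hQ => (hsub Q (hF Q hQ)).trans (hA Q hQ))

theorem IsSparse.mul_sum_vol_le_sum_maximalCubes {n : ℕ} {η : ℝ} (hη : 0 < η)
    {S : Set (Cube n)} (hS : IsSparse η S) {F : Finset (Cube n)} (hF : ∀ Q ∈ F, Q ∈ S) :
    η * ∑ Q ∈ F, Q.vol ≤ ∑ Q ∈ Cube.maximalCubes F, Q.vol := by
  have h := hS.sum_vol_le hF (A := ⋃ Q ∈ Cube.maximalCubes F, Q.carrier) fun Q hQ => by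
    obtain ⟨Q', hQ', hsub⟩ := Cube.exists_mem_maximalCubes hQ
    exact hsub.trans (subset_biUnion_of_mem (u := fun Q : Cube n => Q.carrier) hQ')
  have h2 := h.trans (measure_biUnion_finset_le _ _)
  simp_rw [Cube.volume_carrier] at h2
  rw [← ENNReal.ofReal_sum_of_nonneg fun Q _ => (mul_pos hη Q.vol_pos).le,
    ← ENNReal.ofReal_sum_of_nonneg fun Q _ => Q.vol_pos.le, ← Finset.mul_sum,
    ENNReal.ofReal_le_ofReal_iff (Finset.sum_nonneg fun Q _ => Q.vol_pos.le)] at h2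
  exact h2

theorem IsSparse.sum_vol_le_vol_div {n : ℕ} {η : ℝ} (hη : 0 < η)
    {S : Set (Cube n)} (hS : IsSparse η S) {F : Finset (Cube n)} (hF : ∀ Q ∈ F, Q ∈ S)
    {R : Cube n} (hR : ∀ Q ∈ F, Q.carrier ⊆ R.carrier) :
    ∑ Q ∈ F, Q.vol ≤ 1 / η * R.vol := by
  have h := hS.sum_vol_le hF hR
  rw [Cube.volume_carrier,
    ← ENNReal.ofReal_sum_of_nonneg fun Q _ => (mul_pos hη Q.vol_pos).le,
    ← Finset.mul_sum, ENNReal.ofReal_le_ofReal_iff R.vol_pos.le] at h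
  rw [one_div, ← div_eq_inv_mul, le_div_iff₀' hη]
  exact h

namespace ENNReal

/-- Hölder's inequality for finite sums of products of three powers. -/
theorem sum_rpow_mul_rpow_mul_rpow_le {ι : Type*} (s : Finset ι) (f g h : ι → ℝ≥0∞)
    {a b c : ℝ} (ha : 0 ≤ a) (hb : 0 ≤ b) (hc : 0 ≤ c) (habc : a + b + c = 1) :
    ∑ i ∈ s, f i ^ a * g i ^ b * h i ^ c ≤
      (∑ i ∈ s, f i) ^ a * (∑ i ∈ s, g i) ^ b * (∑ i ∈ s, h i) ^ c := by
  let _ : MeasurableSpace s := ⊤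
  have key := lintegral_prod_norm_pow_le (μ := (Measure.count : Measure s)) Finset.univ
    (f := ![fun i => f i, fun i => g i, fun i => h i]) (p := ![a, b, c])
    (fun i _ => (measurable_from_top).aemeasurable)
    (by simpa [Fin.sum_univ_three] using habc)
    (by intro i _; fin_cases i <;> simpa)
  simpa [Fin.prod_univ_three, lintegral_fintype, Finset.sum_attach s f, Finset.sum_attach s g,
    Finset.sum_attach s h, Finset.sum_attach s (fun i => f i ^ a * g i ^ b * h i ^ c)] using key

theorem sum_rpow_le_rpow_sum {ι : Type*} (s : Finset ι) (f : ι → ℝ≥0∞) {t : ℝ}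
    (ht : 1 ≤ t) : ∑ i ∈ s, f i ^ t ≤ (∑ i ∈ s, f i) ^ t := by
  classical
  induction s using Finset.induction_on with
  | empty => simp
  | insert i s hi ih =>
    rw [Finset.sum_insert hi, Finset.sum_insert hi]
    exact (add_le_add le_rfl ih).trans (ENNReal.add_rpow_le_rpow_add _ _ ht)

end ENNReal

open Cube in
/-- The sparse estimate for finite families, in the scale-invariant case `a + b + c = 1`. -/
theorem IsSparse.sum_rpow_le {n : ℕ} (hn : 1 ≤ n) {η a b c : ℝ} (hη : 0 < η) (hη1 : η ≤ 1)
    (ha : 0 < a) (hb : 0 ≤ b) (hc : 0 ≤ c) (habc : a + b + c = 1)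
    {μ ν : Measure (Fin n → ℝ)} (hμ : μ ≪ volume) (hν : ν ≪ volume)
    {S : Set (Cube n)} (hdy : ∀ Q ∈ S, Q.IsDyadic) (hS : IsSparse η S) (R : Cube n)
    (F : Finset (Cube n)) (hF : ∀ Q ∈ F, Q ∈ S ∧ Q.carrier ⊆ R.carrier) :
    ∑ Q ∈ F, ENNReal.ofReal Q.vol ^ a * μ Q.carrier ^ b * ν Q.carrier ^ c ≤
      ENNReal.ofReal (1 / (1 - (1 - η) ^ a)) *
        (ENNReal.ofReal (∑ Q ∈ F, Q.vol) ^ a * μ R.carrier ^ b * ν R.carrier ^ c) := by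
  classical
  set C := 1 / (1 - (1 - η) ^ a) with hC
  have hη0 : 0 ≤ 1 - η := by linarith
  have hpow : (1 - η) ^ a < 1 := Real.rpow_lt_one hη0 (by linarith) ha
  have hCpos : 0 < C := one_div_pos.2 (by linarith)
  have hCeq : 1 + C * (1 - η) ^ a = C := by
    rw [hC]
    have : 1 - (1 - η) ^ a ≠ 0 := by linarith
    field_simp
    ring
  induction F using Finset.strongInduction with
  | H F ih =>
    rcases F.eq_empty_or_nonempty with rfl | ⟨Q₀, hQ₀⟩
    · simp
    set M := maximalCubes F
    have hMF : M ⊆ F := maximalCubes_subset F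
    obtain ⟨P, hP, -⟩ := exists_mem_maximalCubes hQ₀
    have hss : F \ M ⊂ F := Finset.sdiff_ssubset hMF ⟨P, hP⟩
    have hrest := ih (F \ M) hss fun Q hQ => hF Q (hss.subset hQ)
    have hFdy : ∀ Q ∈ F, Q.IsDyadic := fun Q hQ => hdy Q (hF Q hQ).1
    have hFR : ∀ Q ∈ F, Q.carrier ⊆ R.carrier := fun Q hQ => (hF Q hQ).2
    have hsplit := Finset.sum_sdiff hMF (f := Cube.vol)
    have hT : η * ∑ Q ∈ F, Q.vol ≤ ∑ Q ∈ M, Q.vol :=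
      hS.mul_sum_vol_le_sum_maximalCubes hη fun Q hQ => (hF Q hQ).1
    have hM0 : 0 ≤ ∑ Q ∈ F \ M, Q.vol := Finset.sum_nonneg fun Q _ => Q.vol_pos.le
    set T := ∑ Q ∈ F, Q.vol
    set s := μ R.carrier ^ b * ν R.carrier ^ c with hs
    have hmax : ∑ Q ∈ M, ENNReal.ofReal Q.vol ^ a * μ Q.carrier ^ b * ν Q.carrier ^ c ≤
        ENNReal.ofReal T ^ a * s := by
      refine (ENNReal.sum_rpow_mul_rpow_mul_rpow_le M _ _ _ ha.le hb hc habc).trans ?_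
      rw [hs, ← mul_assoc]
      gcongr
      · rw [← ENNReal.ofReal_sum_of_nonneg fun Q _ => Q.vol_pos.le]
        exact ENNReal.ofReal_le_ofReal (by linarith)
      · exact sum_measure_maximalCubes_le hn hFdy hFR hμ
      · exact sum_measure_maximalCubes_le hn hFdy hFR hν
    have hdecay : ENNReal.ofReal (∑ Q ∈ F \ M, Q.vol) ^ a ≤
        ENNReal.ofReal ((1 - η) ^ a) * ENNReal.ofReal T ^ a := by
      rw [← ENNReal.ofReal_rpow_of_nonneg hη0 ha.le, ← ENNReal.mul_rpow_of_nonneg _ _ ha.le,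
        ← ENNReal.ofReal_mul hη0]
      gcongr
      linarith
    rw [← Finset.sum_sdiff hMF, mul_assoc _ (μ R.carrier ^ b), ← hs]
    rw [mul_assoc _ (μ R.carrier ^ b), ← hs] at hrest
    calc _ ≤ ENNReal.ofReal C * (ENNReal.ofReal ((1 - η) ^ a) * ENNReal.ofReal T ^ a * s) +
          ENNReal.ofReal T ^ a * s := by
          refine add_le_add (hrest.trans ?_) hmax
          gcongr
      _ = (1 + ENNReal.ofReal C * ENNReal.ofReal ((1 - η) ^ a)) *
          (ENNReal.ofReal T ^ a * s) := by ring
      _ = ENNReal.ofReal C * (ENNReal.ofReal T ^ a * s) := by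
          rw [← ENNReal.ofReal_mul hCpos.le, ← ENNReal.ofReal_one,
            ← ENNReal.ofReal_add zero_le_one (by positivity), hCeq]

/-- the universal sparse estimate
`Σ_{Q∈S, Q⊆R} |Q|^α σ(Q)^β ω(Q)^γ ≲ |R|^α σ(R)^β ω(R)^γ` for `α > 0`, `α + β + γ ≥ 1`. -/
theorem stmt8 (n : ℕ) (hn : 1 ≤ n) (η α β γ : ℝ) (hη : 0 < η) (hη1 : η ≤ 1)
    (hα : 0 < α) (hβ : 0 ≤ β) (hγ : 0 ≤ γ) (hsum : 1 ≤ α + β + γ) :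
    ∃ C : ℝ, 0 < C ∧
      ∀ ω σ' : (Fin n → ℝ) → ℝ, IsWeight ω → IsWeight σ' →
      ∀ S : Set (Cube n), (∀ Q ∈ S, Q.IsDyadic) → IsSparse η S →
      ∀ R : Cube n,
        (∑' Q : {Q : Cube n // Q ∈ S ∧ Q.carrier ⊆ R.carrier},
            (ENNReal.ofReal Q.1.vol) ^ α * wMass σ' Q.1 ^ β * wMass ω Q.1 ^ γ) ≤
          ENNReal.ofReal C *
            ((ENNReal.ofReal R.vol) ^ α * wMass σ' R ^ β * wMass ω R ^ γ) := by
  set t := α + β + γ with ht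
  have ht0 : 0 < t := by linarith
  have hα' : 0 < α / t := div_pos hα ht0
  have hβ' : 0 ≤ β / t := div_nonneg hβ ht0.le
  have hγ' : 0 ≤ γ / t := div_nonneg hγ ht0.le
  have hone : α / t + β / t + γ / t = 1 := by
    rw [← add_div, ← add_div, ← ht, div_self ht0.ne']
  have hpow : (1 - η) ^ (α / t) < 1 := Real.rpow_lt_one (by linarith) (by linarith) hα'
  have hC₀ : 0 < 1 / (1 - (1 - η) ^ (α / t)) := one_div_pos.2 (by linarith)
  set C₀ := 1 / (1 - (1 - η) ^ (α / t)) with hC₀def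
  have hη' : 0 < 1 / η := one_div_pos.2 hη
  have hC : 0 < C₀ * (1 / η) ^ (α / t) := mul_pos hC₀ (Real.rpow_pos_of_pos hη' _)
  refine ⟨(C₀ * (1 / η) ^ (α / t)) ^ t, Real.rpow_pos_of_pos hC t, ?_⟩
  intro ω σ' _ _ S hdy hS R
  have hsplit (x y z : ℝ≥0∞) :
      x ^ α * y ^ β * z ^ γ = (x ^ (α / t) * y ^ (β / t) * z ^ (γ / t)) ^ t := by
    rw [ENNReal.mul_rpow_of_nonneg _ _ ht0.le, ENNReal.mul_rpow_of_nonneg _ _ ht0.le,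
      ← ENNReal.rpow_mul, ← ENNReal.rpow_mul, ← ENNReal.rpow_mul,
      div_mul_cancel₀ _ ht0.ne', div_mul_cancel₀ _ ht0.ne', div_mul_cancel₀ _ ht0.ne']
  simp_rw [hsplit, wMass_eq_withDensity]
  rw [← ENNReal.ofReal_rpow_of_pos hC, ← ENNReal.mul_rpow_of_nonneg _ _ ht0.le,
    ENNReal.tsum_eq_iSup_sum]
  refine iSup_le fun F => (ENNReal.sum_rpow_le_rpow_sum F _ hsum).trans ?_
  gcongr
  have hG : ∀ Q ∈ F.map (Function.Embedding.subtype _), Q ∈ S ∧ Q.carrier ⊆ R.carrier := by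
    intro Q hQ
    obtain ⟨P, -, rfl⟩ := Finset.mem_map.1 hQ
    exact P.2
  have key := hS.sum_rpow_le hn hη hη1 hα' hβ' hγ' hone
    (withDensity_absolutelyContinuous volume fun x => ENNReal.ofReal (σ' x))
    (withDensity_absolutelyContinuous volume fun x => ENNReal.ofReal (ω x)) hdy R _ hG
  have hvol := hS.sum_vol_le_vol_div hη (fun Q hQ => (hG Q hQ).1) fun Q hQ => (hG Q hQ).2
  rw [Finset.sum_map] at key
  refine key.trans ?_
  rw [ENNReal.ofReal_mul hC₀.le, mul_assoc (ENNReal.ofReal C₀),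
    ← ENNReal.ofReal_rpow_of_pos hη']
  refine mul_le_mul' le_rfl ?_
  rw [← mul_assoc, ← mul_assoc, ← ENNReal.mul_rpow_of_nonneg _ _ hα'.le,
    ← ENNReal.ofReal_mul hη'.le]
  gcongr
end
end

section
/- Let ω, σ be weights on ℝⁿ with [ω]_{A∞} < ∞ and [σ]_{A∞} < ∞, and let β, γ ≥ 0 with β + γ ≥ 1. Let 𝒮 be an η-sparse collection of dyadic cubes and R a cube. Then there is a constant C depending only on n, η, β, γ such that Σ_{Q∈𝒮, Q⊆R} σ(Q)^β ω(Q)^γ ≤ C · [σ]_{A∞}^β [ω]_{A∞}^γ · σ(R)^β ω(R)^γ. -/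
open MeasureTheory ENNReal Set

noncomputable section

theorem ENNReal.sum_rpow_le_rpow_sum_s9 {ι : Type*} (t : Finset ι) (a : ι → ℝ≥0∞) {s : ℝ}
    (hs : 1 ≤ s) : ∑ i ∈ t, a i ^ s ≤ (∑ i ∈ t, a i) ^ s := by
  classical
  induction t using Finset.induction_on with
  | empty => simp
  | insert i t hi ih =>
    rw [Finset.sum_insert hi, Finset.sum_insert hi]
    exact (add_le_add le_rfl ih).trans (ENNReal.add_rpow_le_rpow_add _ _ hs)

theorem ENNReal.tsum_rpow_le_rpow_tsum {ι : Type*} (a : ι → ℝ≥0∞) {s : ℝ} (hs : 1 ≤ s) :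
    ∑' i, a i ^ s ≤ (∑' i, a i) ^ s := by
  rw [ENNReal.tsum_eq_iSup_sum]
  refine iSup_le fun t => (ENNReal.sum_rpow_le_rpow_sum_s9 t a hs).trans ?_
  exact ENNReal.rpow_le_rpow (ENNReal.sum_le_tsum t) (by linarith)

/-- Hölder's inequality for series with conjugate exponents `1 / p` and `1 / q`. -/
theorem ENNReal.tsum_rpow_mul_rpow_le {ι : Type*} (f g : ι → ℝ≥0∞) {p q : ℝ}
    (hp : 0 ≤ p) (hq : 0 ≤ q) (hpq : p + q = 1) :
    ∑' i, f i ^ p * g i ^ q ≤ (∑' i, f i) ^ p * (∑' i, g i) ^ q := by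
  let _ : MeasurableSpace ι := ⊤
  have h := ENNReal.lintegral_mul_norm_pow_le (μ := Measure.count)
    (measurable_from_top (f := f)).aemeasurable (measurable_from_top (f := g)).aemeasurable
    hp hq hpq
  simpa only [lintegral_count] using h

theorem Cube.carrier_eq_Icc_s9 {n : ℕ} (Q : Cube n) :
    Q.carrier = Icc Q.corner (fun i => Q.corner i + Q.side) := by
  ext x
  simp [Cube.carrier, Pi.le_def, forall_and]

theorem Cube.measurableSet_carrier_s9 {n : ℕ} (Q : Cube n) : MeasurableSet Q.carrier := by
  rw [Q.carrier_eq_Icc_s9]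
  exact measurableSet_Icc

theorem wMass_ne_top {n : ℕ} {w : (Fin n → ℝ) → ℝ} (hw : IsWeight w) (Q : Cube n) :
    wMass w Q ≠ ∞ := by
  have hi : IntegrableOn w Q.carrier := by
    rw [Q.carrier_eq_Icc_s9]
    exact hw.1.integrableOn_isCompact isCompact_Icc
  exact hi.lintegral_lt_top.ne

theorem lintegral_maximal_le {n : ℕ} {w : (Fin n → ℝ) → ℝ} (hw : IsWeight w)
    (hA : AinfChar w < ∞) (R : Cube n) :
    ∫⁻ x in R.carrier, maximal (R.carrier.indicator w) x ≤ AinfChar w * wMass w R := by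
  have h : (wMass w R)⁻¹ * ∫⁻ x in R.carrier, maximal (R.carrier.indicator w) x ≤ AinfChar w :=
    le_iSup (fun Q : Cube n => (wMass w Q)⁻¹ *
      ∫⁻ x in Q.carrier, maximal (Q.carrier.indicator w) x) R
  by_cases h0 : wMass w R = 0
  · have hI : ∫⁻ x in R.carrier, maximal (R.carrier.indicator w) x = 0 := by
      by_contra hne
      rw [h0, ENNReal.inv_zero, ENNReal.top_mul hne] at h
      exact absurd hA (not_lt.2 h)
    rw [hI]
    exact zero_le
  · rw [mul_comm, ← div_eq_mul_inv] at h
    exact (ENNReal.div_le_iff h0 (wMass_ne_top hw R)).1 h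

theorem average_le_maximal {n : ℕ} {w : (Fin n → ℝ) → ℝ} (hw : IsWeight w) {Q R : Cube n}
    (hQR : Q.carrier ⊆ R.carrier) {x : Fin n → ℝ} (hx : x ∈ Q.carrier) :
    (ENNReal.ofReal Q.vol)⁻¹ * wMass w Q ≤ maximal (R.carrier.indicator w) x := by
  have h : wMass w Q = ∫⁻ y in Q.carrier, ENNReal.ofReal |R.carrier.indicator w y| := by
    refine setLIntegral_congr_fun Q.measurableSet_carrier_s9 fun y hy => ?_
    simp only [indicator_of_mem (hQR hy), abs_of_nonneg (hw.2 y)]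
  rw [h]
  exact le_iSup₂ (f := fun (Q : Cube n) (_ : x ∈ Q.carrier) => (ENNReal.ofReal Q.vol)⁻¹ *
    ∫⁻ y in Q.carrier, ENNReal.ofReal |R.carrier.indicator w y|) Q hx

/-- The Carleson packing property of sparse families with respect to an `A∞` weight. -/
theorem IsSparse.tsum_wMass_le {n : ℕ} {η : ℝ} (hη : 0 < η) {S : Set (Cube n)}
    (hS : IsSparse η S) {w : (Fin n → ℝ) → ℝ} (hw : IsWeight w) (hA : AinfChar w < ∞)
    (R : Cube n) :
    ∑' Q : {Q : Cube n // Q ∈ S ∧ Q.carrier ⊆ R.carrier}, wMass w Q.1 ≤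
      (ENNReal.ofReal η)⁻¹ * (AinfChar w * wMass w R) := by
  obtain ⟨E, hEm, hEQ, hEd, hEv⟩ := hS
  have hη0 : ENNReal.ofReal η ≠ 0 := (ENNReal.ofReal_pos.2 hη).ne'
  rw [ENNReal.tsum_eq_iSup_sum]
  refine iSup_le fun t => ?_
  have hterm : ∀ Q : {Q : Cube n // Q ∈ S ∧ Q.carrier ⊆ R.carrier}, wMass w Q.1 ≤
      (ENNReal.ofReal η)⁻¹ * ∫⁻ x in E Q.1, maximal (R.carrier.indicator w) x := by
    rintro ⟨Q, hQS, hQR⟩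
    have hv : 0 < Q.vol := pow_pos Q.side_pos n
    have hv0 : ENNReal.ofReal Q.vol ≠ 0 := (ENNReal.ofReal_pos.2 hv).ne'
    have hE : (ENNReal.ofReal Q.vol)⁻¹ * wMass w Q * volume (E Q) ≤
        ∫⁻ x in E Q, maximal (R.carrier.indicator w) x := by
      rw [← setLIntegral_const]
      exact setLIntegral_mono' (hEm Q hQS) fun x hx => average_le_maximal hw hQR (hEQ Q hQS hx)
    calc wMass w Q
        = (ENNReal.ofReal η)⁻¹ * ENNReal.ofReal η *
          ((ENNReal.ofReal Q.vol)⁻¹ * ENNReal.ofReal Q.vol) * wMass w Q := by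
          rw [ENNReal.inv_mul_cancel hη0 ENNReal.ofReal_ne_top,
            ENNReal.inv_mul_cancel hv0 ENNReal.ofReal_ne_top, one_mul, one_mul]
      _ = (ENNReal.ofReal η)⁻¹ *
          ((ENNReal.ofReal Q.vol)⁻¹ * wMass w Q * ENNReal.ofReal (η * Q.vol)) := by
          rw [ENNReal.ofReal_mul hη.le]
          ring
      _ ≤ (ENNReal.ofReal η)⁻¹ * ((ENNReal.ofReal Q.vol)⁻¹ * wMass w Q * volume (E Q)) := by
          gcongr
          exact hEv Q hQS
      _ ≤ _ := by gcongr
  calc ∑ Q ∈ t, wMass w Q.1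
      ≤ ∑ Q ∈ t, (ENNReal.ofReal η)⁻¹ *
          ∫⁻ x in E Q.1, maximal (R.carrier.indicator w) x :=
        Finset.sum_le_sum fun Q _ => hterm Q
    _ = (ENNReal.ofReal η)⁻¹ *
          ∫⁻ x in ⋃ Q ∈ t, E Q.1, maximal (R.carrier.indicator w) x := by
        rw [← Finset.mul_sum, lintegral_biUnion_finset _ (fun Q _ => hEm Q.1 Q.2.1)]
        intro Q _ Q' _ hne
        exact hEd Q.2.1 Q'.2.1 fun h => hne (Subtype.ext h)
    _ ≤ (ENNReal.ofReal η)⁻¹ * ∫⁻ x in R.carrier, maximal (R.carrier.indicator w) x := by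
        gcongr
        exact iUnion₂_subset fun Q _ => (hEQ Q.1 Q.2.1).trans Q.2.2
    _ ≤ _ := by
        gcongr
        exact lintegral_maximal_le hw hA R

/-- the `A∞` sparse estimate
`Σ_{Q∈S, Q⊆R} σ(Q)^β ω(Q)^γ ≲ [σ]_{A∞}^β [ω]_{A∞}^γ σ(R)^β ω(R)^γ` for `β + γ ≥ 1`. -/
theorem stmt9 (n : ℕ) (hn : 1 ≤ n) (η β γ : ℝ) (hη : 0 < η) (hη1 : η ≤ 1)
    (hβ : 0 ≤ β) (hγ : 0 ≤ γ) (hsum : 1 ≤ β + γ) :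
    ∃ C : ℝ, 0 < C ∧
      ∀ ω σ' : (Fin n → ℝ) → ℝ, IsWeight ω → IsWeight σ' →
        AinfChar ω < ∞ → AinfChar σ' < ∞ →
      ∀ S : Set (Cube n), (∀ Q ∈ S, Q.IsDyadic) → IsSparse η S →
      ∀ R : Cube n,
        (∑' Q : {Q : Cube n // Q ∈ S ∧ Q.carrier ⊆ R.carrier},
            wMass σ' Q.1 ^ β * wMass ω Q.1 ^ γ) ≤
          ENNReal.ofReal C *
            (AinfChar σ' ^ β * AinfChar ω ^ γ * wMass σ' R ^ β * wMass ω R ^ γ) := by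
  have hs0 : 0 < β + γ := by linarith
  refine ⟨(η ^ (β + γ))⁻¹, inv_pos.2 (Real.rpow_pos_of_pos hη _),
    fun ω σ' hω hσ hωA hσA S _ hS R => ?_⟩
  have hσS := hS.tsum_wMass_le hη hσ hσA R
  have hωS := hS.tsum_wMass_le hη hω hωA R
  have hβs : β / (β + γ) * (β + γ) = β := div_mul_cancel₀ _ hs0.ne'
  have hγs : γ / (β + γ) * (β + γ) = γ := div_mul_cancel₀ _ hs0.ne'
  calc ∑' Q : {Q : Cube n // Q ∈ S ∧ Q.carrier ⊆ R.carrier}, wMass σ' Q.1 ^ β * wMass ω Q.1 ^ γ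
      = ∑' Q : {Q : Cube n // Q ∈ S ∧ Q.carrier ⊆ R.carrier},
          (wMass σ' Q.1 ^ (β / (β + γ)) * wMass ω Q.1 ^ (γ / (β + γ))) ^ (β + γ) := by
        refine tsum_congr fun Q => ?_
        rw [ENNReal.mul_rpow_of_nonneg _ _ hs0.le, ← ENNReal.rpow_mul, ← ENNReal.rpow_mul,
          hβs, hγs]
    _ ≤ (∑' Q : {Q : Cube n // Q ∈ S ∧ Q.carrier ⊆ R.carrier},
          wMass σ' Q.1 ^ (β / (β + γ)) * wMass ω Q.1 ^ (γ / (β + γ))) ^ (β + γ) :=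
        ENNReal.tsum_rpow_le_rpow_tsum _ hsum
    _ ≤ ((∑' Q : {Q : Cube n // Q ∈ S ∧ Q.carrier ⊆ R.carrier}, wMass σ' Q.1) ^ (β / (β + γ)) *
          (∑' Q : {Q : Cube n // Q ∈ S ∧ Q.carrier ⊆ R.carrier}, wMass ω Q.1) ^
            (γ / (β + γ))) ^ (β + γ) := by
        gcongr
        exact ENNReal.tsum_rpow_mul_rpow_le _ _ (by positivity) (by positivity)
          (by field_simp)
    _ = (∑' Q : {Q : Cube n // Q ∈ S ∧ Q.carrier ⊆ R.carrier}, wMass σ' Q.1) ^ β *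
          (∑' Q : {Q : Cube n // Q ∈ S ∧ Q.carrier ⊆ R.carrier}, wMass ω Q.1) ^ γ := by
        rw [ENNReal.mul_rpow_of_nonneg _ _ hs0.le, ← ENNReal.rpow_mul, ← ENNReal.rpow_mul,
          hβs, hγs]
    _ ≤ ((ENNReal.ofReal η)⁻¹ * (AinfChar σ' * wMass σ' R)) ^ β *
          ((ENNReal.ofReal η)⁻¹ * (AinfChar ω * wMass ω R)) ^ γ := by gcongr
    _ = _ := by
        have hC : ENNReal.ofReal (η ^ (β + γ))⁻¹ =
            (ENNReal.ofReal η)⁻¹ ^ β * (ENNReal.ofReal η)⁻¹ ^ γ := by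
          rw [ENNReal.ofReal_inv_of_pos (Real.rpow_pos_of_pos hη _),
            ← ENNReal.ofReal_rpow_of_pos hη, ← ENNReal.inv_rpow,
            ENNReal.rpow_add_of_nonneg _ _ hβ hγ]
        rw [hC]
        simp only [ENNReal.mul_rpow_of_nonneg _ _ hβ, ENNReal.mul_rpow_of_nonneg _ _ hγ]
        ring
end
end
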